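/- arXiv:1507.01364 — 2 statements merged into one kernel-verified Lean document; each statement's English description precedes it below -/
import Mathlib

section
/- Let G be a connected finite simple graph of order n with maximum degree Δ ≥ 2. If (Δ−1)·Z(G) = (Δ−2)·n + 2, then G is isomorphic to the cycle C_n, to the complete graph K_{Δ+1}, or to the complete bipartite graph K_{Δ,Δ}. -/
/-- The zero forcing closure: `v` eventually becomes colored starting from `S`,
under the rule that a colored vertex all of whose other neighbors are colored
forces its remaining neighbor to become colored. -/
inductive SimpleGraph.ZeroForces {V : Type*} (G : SimpleGraph V) (S : Set V) : V → Prop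
  | init {v : V} (hv : v ∈ S) : SimpleGraph.ZeroForces G S v
  | force {u w : V} (hu : SimpleGraph.ZeroForces G S u) (hadj : G.Adj u w)
      (hall : ∀ v, G.Adj u v → v ≠ w → SimpleGraph.ZeroForces G S v) :
      SimpleGraph.ZeroForces G S w

/-- `S` is a zero forcing set of `G` if every vertex eventually becomes colored. -/
def SimpleGraph.IsZeroForcingSet {V : Type*} (G : SimpleGraph V) (S : Set V) : Prop :=
  ∀ v, G.ZeroForces S v

/-- The zero forcing number of `G`: minimum cardinality of a zero forcing set. -/
noncomputable def SimpleGraph.zeroForcingNumber {V : Type*} (G : SimpleGraph V) : ℕ :=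
  sInf {n | ∃ S : Set V, G.IsZeroForcingSet S ∧ S.ncard = n}

namespace SimpleGraph

variable {V : Type*} {G : SimpleGraph V}

lemma ZeroForces.mono {S T : Set V} (h : ∀ v ∈ S, G.ZeroForces T v) {v : V}
    (hv : G.ZeroForces S v) : G.ZeroForces T v := by
  induction hv with
  | init hv => exact h _ hv
  | force _ hadj _ ihu ihall => exact .force ihu hadj ihall

/-- A nonempty set `C` without isolated vertices is the zero forcing closure of some `S` with
`(k + 1) * #S ≤ k * #C + a`. -/
def IsForcedWithin (G : SimpleGraph V) (k : ℕ) (a : ℤ) (C : Finset V) : Prop :=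
  C.Nonempty ∧ (∀ c ∈ C, ∃ d ∈ C, G.Adj c d) ∧
    ∃ S : Finset V, (∀ v, G.ZeroForces S v ↔ v ∈ C) ∧ ((k : ℤ) + 1) * S.card - k * C.card ≤ a

lemma IsForcedWithin.mono {k : ℕ} {a b : ℤ} {C : Finset V} (h : G.IsForcedWithin k a C)
    (hab : a ≤ b) : G.IsForcedWithin k b C := by
  obtain ⟨h1, h2, S, h3, h4⟩ := h
  exact ⟨h1, h2, S, h3, h4.trans hab⟩

lemma exists_isForcedWithin [Fintype V] (k : ℕ) {S D : Finset V} (hne : D.Nonempty) (hSD : S ⊆ D)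
    (hD : ∀ c ∈ D, ∃ d ∈ D, G.Adj c d) (hDS : ∀ c ∈ D, G.ZeroForces S c) :
    ∃ C, D ⊆ C ∧ G.IsForcedWithin k (((k : ℤ) + 1) * S.card - k * C.card) C := by
  classical
  have hDC : D ⊆ Finset.univ.filter (G.ZeroForces S) := fun c hc ↦ by simp [hDS c hc]
  refine ⟨Finset.univ.filter (G.ZeroForces S), hDC, hne.mono hDC, fun c hc ↦ ?_, S, by simp,
    le_rfl⟩
  have hc' : G.ZeroForces S c := by simpa using hc
  cases hc' with
  | init h =>
    obtain ⟨d, hd, hcd⟩ := hD c (hSD h)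
    exact ⟨d, hDC hd, hcd⟩
  | force hu hadj _ => exact ⟨_, by simpa using hu, hadj.symm⟩

lemma Connected.exists_adj_notMem [Fintype V] (hG : G.Connected) {C : Finset V} (hne : C.Nonempty)
    (hC : C ≠ Finset.univ) : ∃ v ∈ C, ∃ w ∉ C, G.Adj v w := by
  obtain ⟨x, hx⟩ := hne
  obtain ⟨y, hy⟩ : ∃ y, y ∉ C := by simpa [Finset.eq_univ_iff_forall] using hC
  obtain ⟨p⟩ := hG.preconnected x y
  obtain ⟨d, -, h1, h2⟩ := p.exists_boundary_dart (C : Set V) (by simpa using hx) (by simpa using hy)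
  exact ⟨d.fst, by simpa using h1, d.snd, by simpa using h2, d.adj⟩

lemma IsZeroForcingSet.zeroForcingNumber_le {T : Finset V} (hT : G.IsZeroForcingSet T) :
    G.zeroForcingNumber ≤ T.card :=
  Nat.sInf_le ⟨T, hT, Set.ncard_coe_finset T⟩

variable [Fintype V] [DecidableEq V] [DecidableRel G.Adj]

lemma exists_isForcedWithin_insert_neighborFinset (k : ℕ) {u w : V} (huw : G.Adj u w) :
    ∃ C, insert u (G.neighborFinset u) ⊆ C ∧
      G.IsForcedWithin k (((k : ℤ) + 1) * G.degree u - k * C.card) C := by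
  have hcard : (insert u ((G.neighborFinset u).erase w)).card = G.degree u := by
    rw [Finset.card_insert_of_notMem (by simp), Finset.card_erase_add_one (by simpa using huw)]
    simp
  rw [← hcard]
  refine exists_isForcedWithin k (by simp) (by grind) ?_ ?_
  · intro c hc
    by_cases hcu : c = u
    · exact ⟨w, by simp [huw], hcu ▸ huw⟩
    · exact ⟨u, by simp, by simpa [hcu, G.adj_comm] using hc⟩
  · intro c hc
    by_cases hcw : c = w
    · subst hcw
      exact .force (u := u) (.init (by simp)) huw fun v hv hvc ↦ .init (by simp [hv, hvc])
    · refine .init ?_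
      simp only [Finset.mem_insert, mem_neighborFinset] at hc
      simp [hcw, hc]

lemma IsForcedWithin.exists_union_neighborFinset {k : ℕ} {a : ℤ} {C : Finset V}
    (h : G.IsForcedWithin k a C) {v w : V} (hv : v ∈ C) (hw : w ∉ C) (hvw : G.Adj v w) :
    ∃ C', C ∪ G.neighborFinset v ⊆ C' ∧ G.IsForcedWithin k
      (a - (k + 1 - (G.neighborFinset v \ C).card)
        - k * ((C'.card : ℤ) - (C ∪ G.neighborFinset v).card)) C' := by
  obtain ⟨hne, hnice, S, hS, hcard⟩ := h
  have hT : ∀ c ∈ C, G.ZeroForces ((S ∪ (G.neighborFinset v \ C).erase w : Finset V) : Set V) c :=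
    fun c hc ↦ ((hS c).2 hc).mono fun x hx ↦ .init (by simp at hx; simp [hx])
  obtain ⟨C', h1, h2⟩ := exists_isForcedWithin (G := G) k
    (S := S ∪ (G.neighborFinset v \ C).erase w) (D := C ∪ G.neighborFinset v)
    (hne.mono Finset.subset_union_left)
    (by
      intro x hx
      have := fun hx ↦ (hS x).1 (.init hx)
      simp only [SetLike.mem_coe] at this
      grind)
    (by
      intro c hc
      by_cases hcC : c ∈ C
      · obtain ⟨d, hd, hcd⟩ := hnice c hcC
        exact ⟨d, by simp [hd], hcd⟩
      · exact ⟨v, by simp [hv], by simpa [hcC, G.adj_comm] using hc⟩)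
    (by
      intro c hc
      by_cases hcC : c ∈ C
      · exact hT c hcC
      have hvc : G.Adj v c := by simpa [hcC] using hc
      by_cases hcw : c = w
      · subst hcw
        refine .force (hT v hv) hvc fun x hx hxc ↦ ?_
        by_cases hxC : x ∈ C
        · exact hT x hxC
        · exact .init (by simp [hx, hxC, hxc])
      · exact .init (by simp [hvc, hcC, hcw]))
  refine ⟨C', h1, h2.mono ?_⟩
  have e1 := Finset.card_union_le S ((G.neighborFinset v \ C).erase w)
  have e2 := Finset.card_erase_add_one (s := G.neighborFinset v \ C) (a := w) (by simp [hvw, hw])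
  have e3 : (C ∪ G.neighborFinset v).card = C.card + (G.neighborFinset v \ C).card := by
    rw [← Finset.card_union_of_disjoint Finset.disjoint_sdiff, Finset.union_sdiff_self_eq_union]
  have e4 : ((S ∪ (G.neighborFinset v \ C).erase w).card : ℤ) + 1
      ≤ S.card + (G.neighborFinset v \ C).card := by lia
  rw [e3]
  push_cast
  nlinarith

lemma IsForcedWithin.card_neighborFinset_sdiff_le {k : ℕ} {a : ℤ} {C : Finset V}
    (h : G.IsForcedWithin k a C) (hdeg : ∀ v, G.degree v ≤ k + 2) {v : V} (hv : v ∈ C) :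
    (G.neighborFinset v \ C).card ≤ k + 1 := by
  obtain ⟨d, hd, hvd⟩ := h.2.1 v hv
  have : G.neighborFinset v \ C ⊂ G.neighborFinset v :=
    (Finset.ssubset_iff_of_subset Finset.sdiff_subset).2 ⟨d, by simp [hvd], by simp [hd]⟩
  have := Finset.card_lt_card this
  have := hdeg v
  rw [card_neighborFinset_eq_degree] at *
  lia

lemma IsForcedWithin.exists_isZeroForcingSet (hG : G.Connected) {k : ℕ}
    (hdeg : ∀ v, G.degree v ≤ k + 2) {a : ℤ} {C : Finset V} (h : G.IsForcedWithin k a C) :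
    ∃ T : Finset V, G.IsZeroForcingSet T ∧
      ((k : ℤ) + 1) * T.card ≤ k * Fintype.card V + a := by
  induction hm : Fintype.card V - C.card using Nat.strong_induction_on generalizing a C with
  | _ m ih =>
  by_cases hC : C = Finset.univ
  · obtain ⟨-, -, S, hS, hcard⟩ := h
    subst hC
    refine ⟨S, fun v ↦ (hS v).2 (by simp), ?_⟩
    rw [Finset.card_univ] at hcard
    linarith
  · obtain ⟨v, hv, w, hw, hvw⟩ := hG.exists_adj_notMem h.1 hC
    obtain ⟨C', h1, h2⟩ := h.exists_union_neighborFinset hv hw hvw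
    have hle := h.card_neighborFinset_sdiff_le hdeg hv
    have hlt : C.card < C'.card := Finset.card_lt_card <|
      (Finset.ssubset_iff_of_subset (Finset.subset_union_left.trans h1)).2
        ⟨w, h1 (by simp [hvw]), hw⟩
    have hle' := Finset.card_le_card h1
    refine ih _ ?_ (h2.mono ?_) rfl
    · have := Finset.card_le_univ C'
      lia
    · have : (0 : ℤ) ≤ k * ((C'.card : ℤ) - (C ∪ G.neighborFinset v).card) := by
        apply mul_nonneg <;> lia
      lia

lemma IsRegularOfDegree.nonempty_iso_of_bijective_hom {W : Type*} [Fintype W] {H : SimpleGraph W}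
    [DecidableRel H.Adj] {d : ℕ} (hH : H.IsRegularOfDegree d) (hG : G.IsRegularOfDegree d)
    (f : H →g G) (hf : Function.Bijective f) : Nonempty (G ≃g H) := by
  have key : ∀ i, (H.neighborFinset i).image f = G.neighborFinset (f i) := by
    intro i
    refine Finset.eq_of_subset_of_card_le ?_ ?_
    · intro x hx
      simp only [Finset.mem_image, mem_neighborFinset] at hx
      obtain ⟨j, hj, rfl⟩ := hx
      simpa using f.map_adj hj
    · rw [Finset.card_image_of_injective _ hf.1, card_neighborFinset_eq_degree,
        card_neighborFinset_eq_degree, hH i, hG (f i)]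
  refine ⟨Iso.symm ⟨Equiv.ofBijective f hf, fun {i j} ↦ ⟨fun h ↦ ?_, fun h ↦ f.map_adj h⟩⟩⟩
  have : f j ∈ (H.neighborFinset i).image f := by rw [key]; simpa using h
  simp only [Finset.mem_image, mem_neighborFinset] at this
  obtain ⟨j', hj', he⟩ := this
  exact hf.1 he ▸ hj'

lemma IsRegularOfDegree.nonempty_iso_cycleGraph (hG : G.Connected)
    (hreg : G.IsRegularOfDegree 2) : Nonempty (G ≃g cycleGraph (Fintype.card V)) := by
  have hcard (v : V) : (G.neighborSet v).ncard = 2 := by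
    rw [← hreg v, ← card_neighborSet_eq_degree, Set.ncard_eq_toFinset_card', Set.toFinset_card]
  have hcyc : G.IsCycles := fun v _ ↦ hcard v
  obtain ⟨v⟩ := hG.nonempty
  obtain ⟨p, hp, hverts⟩ := hcyc.exists_cycle_toSubgraph_verts_eq_connectedComponentSupp
    (c := G.connectedComponentMk v) (v := v) rfl
    (Set.nonempty_of_ncard_ne_zero (by simp [hcard]))
  have hmem : ∀ w, w ∈ p.support := by
    intro w
    rw [← p.mem_verts_toSubgraph, hverts]
    exact ConnectedComponent.sound (hG.preconnected w v)
  have hlen : p.length = Fintype.card V := by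
    refine (Walk.isHamiltonianCycle_iff_isCycle_and_support_count_tail_eq_one.2
      ⟨hp, fun w ↦ List.count_eq_one_of_mem hp.support_nodup ?_⟩).length_eq
    obtain rfl | h := p.mem_support_iff.1 (hmem w)
    · exact Walk.end_mem_tail_support hp.not_nil
    · exact h
  have h3 := hp.three_le_length
  obtain ⟨f⟩ :=
    (cycleGraph_isContained_iff (G := G) (n := Fintype.card V) (by lia)).2 ⟨v, p, hp, hlen⟩
  have hbij : Function.Bijective f.toHom :=
    (Fintype.bijective_iff_injective_and_card _).2 ⟨f.injective, by simp⟩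
  refine IsRegularOfDegree.nonempty_iso_of_bijective_hom ?_ hreg f.toHom hbij
  obtain ⟨m, hm⟩ : ∃ m, Fintype.card V = m + 3 := ⟨Fintype.card V - 3, by lia⟩
  clear * - hm
  generalize Fintype.card V = n at hm
  subst hm
  intro i
  convert cycleGraph_degree_three_le (v := i)

lemma IsRegularOfDegree.nonempty_iso_completeBipartiteGraph {d : ℕ} (hreg : G.IsRegularOfDegree d)
    {u v : V} (huv : Disjoint (G.neighborFinset u) (G.neighborFinset v))
    (hcover : G.neighborFinset u ∪ G.neighborFinset v = Finset.univ)
    (hu : ∀ x ∈ G.neighborFinset u, G.neighborFinset x = G.neighborFinset v)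
    (hv : ∀ x ∈ G.neighborFinset v, G.neighborFinset x = G.neighborFinset u) :
    Nonempty (G ≃g completeBipartiteGraph (Fin d) (Fin d)) := by
  have hcompl : ∀ x, x ∉ G.neighborFinset u ↔ x ∈ G.neighborFinset v := fun x ↦
    ⟨fun h ↦ by
      have : x ∈ G.neighborFinset u ∪ G.neighborFinset v := by simp [hcover]
      grind, fun h h' ↦ (Finset.disjoint_left.1 huv h' h)⟩
  let e₁ : {x // x ∈ G.neighborFinset u} ≃ Fin d :=
    Fintype.equivFinOfCardEq (by rw [Fintype.card_coe, card_neighborFinset_eq_degree, hreg u])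
  let e₂ : {x // x ∉ G.neighborFinset u} ≃ Fin d :=
    (Equiv.subtypeEquivRight hcompl).trans <|
    Fintype.equivFinOfCardEq (by rw [Fintype.card_coe, card_neighborFinset_eq_degree, hreg v])
  refine ⟨⟨(Equiv.sumCompl (· ∈ G.neighborFinset u)).symm.trans (e₁.sumCongr e₂), fun {a b} ↦ ?_⟩⟩
  have hadj : G.Adj a b ↔ b ∈ G.neighborFinset a := by simp
  rw [hadj]
  by_cases ha : a ∈ G.neighborFinset u <;> by_cases hb : b ∈ G.neighborFinset u
  all_goals
    first
      | rw [hu a ha]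
      | rw [hv a ((hcompl a).1 ha)]
    have := hcompl b
    simp [Equiv.sumCompl_symm_apply_of_pos, Equiv.sumCompl_symm_apply_of_neg, ha, hb,
      completeBipartiteGraph] at this ⊢
    try tauto

lemma isRegularOfDegree_of_forall_isForcedWithin [Nontrivial V] (hG : G.Connected) {k : ℕ}
    (hdeg : ∀ v, G.degree v ≤ k + 2) (H : ∀ a C, G.IsForcedWithin k a C → 2 ≤ a) :
    G.IsRegularOfDegree (k + 2) := by
  intro u
  obtain ⟨w, huw⟩ := hG.preconnected.exists_adj_of_nontrivial u
  obtain ⟨C, h1, h2⟩ := exists_isForcedWithin_insert_neighborFinset k huw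
  have := H _ _ h2
  have hC := Finset.card_le_card h1
  rw [Finset.card_insert_of_notMem (by simp), card_neighborFinset_eq_degree] at hC
  have := hdeg u
  zify at *
  nlinarith

lemma IsRegularOfDegree.isForcedWithin_insert_neighborFinset {k : ℕ} (hk : 0 < k)
    (hreg : G.IsRegularOfDegree (k + 2)) (H : ∀ a C, G.IsForcedWithin k a C → 2 ≤ a) (u : V) :
    G.IsForcedWithin k 2 (insert u (G.neighborFinset u)) := by
  obtain ⟨w, huw⟩ := (G.degree_pos_iff_exists_adj u).1 (by rw [hreg u]; lia)
  obtain ⟨C, h1, h2⟩ := exists_isForcedWithin_insert_neighborFinset k huw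
  have := H _ _ h2
  have hcard : (insert u (G.neighborFinset u)).card = k + 3 := by
    rw [Finset.card_insert_of_notMem (by simp), card_neighborFinset_eq_degree, hreg u]
  have hC := Finset.card_le_card h1
  rw [hreg u] at h2 this
  have hle : C.card ≤ k + 3 := by
    zify at *
    nlinarith
  rw [Finset.eq_of_subset_of_card_le h1 (by lia)]
  refine h2.mono ?_
  rw [show C.card = k + 3 by lia]
  push_cast
  linarith

lemma IsForcedWithin.eq_of_forall_two_le {k : ℕ} (hk : 0 < k)
    (hdeg : ∀ v, G.degree v ≤ k + 2) (H : ∀ a C, G.IsForcedWithin k a C → 2 ≤ a)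
    {C : Finset V} (h : G.IsForcedWithin k 2 C) {v w : V} (hv : v ∈ C) (hw : w ∉ C)
    (hvw : G.Adj v w) :
    (G.neighborFinset v \ C).card = k + 1 ∧ G.IsForcedWithin k 2 (C ∪ G.neighborFinset v) := by
  obtain ⟨C', h1, h2⟩ := h.exists_union_neighborFinset hv hw hvw
  have := H _ _ h2
  have hle := h.card_neighborFinset_sdiff_le hdeg hv
  have hC := Finset.card_le_card h1
  have hle' : C'.card ≤ (C ∪ G.neighborFinset v).card := by
    zify at *
    nlinarith
  have hcard := hle'.antisymm hC
  rw [hcard] at h2 this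
  simp only [sub_self, mul_zero, sub_zero] at h2 this
  refine ⟨by lia, ?_⟩
  rw [Finset.eq_of_subset_of_card_le h1 hle']
  exact h2.mono (by lia)

lemma IsForcedWithin.neighborFinset_subset {k : ℕ} (hk : 0 < k)
    (hdeg : ∀ v, G.degree v ≤ k + 2) (H : ∀ a C, G.IsForcedWithin k a C → 2 ≤ a)
    {C : Finset V} (h : G.IsForcedWithin k 2 C) {v x y : V} (hv : v ∈ C) (hx : x ∈ C) (hy : y ∈ C)
    (hxy : x ≠ y) (hvx : G.Adj v x) (hvy : G.Adj v y) : G.neighborFinset v ⊆ C := by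
  intro w hvw
  by_contra hw
  have h1 := (h.eq_of_forall_two_le hk hdeg H hv hw (by simpa using hvw)).1
  have h2 : ({x, y} : Finset V) ∪ (G.neighborFinset v \ C) ⊆ G.neighborFinset v := by
    intro z
    simp only [Finset.mem_union, Finset.mem_insert, Finset.mem_singleton, Finset.mem_sdiff,
      mem_neighborFinset]
    rintro ((rfl | rfl) | h) <;> tauto
  have h3 := Finset.card_le_card h2
  rw [Finset.card_union_of_disjoint, Finset.card_pair hxy, h1,
    card_neighborFinset_eq_degree] at h3
  · have := hdeg v
    lia
  · rw [Finset.disjoint_left]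
    simp only [Finset.mem_insert, Finset.mem_singleton, Finset.mem_sdiff]
    rintro z (rfl | rfl) <;> tauto

lemma IsRegularOfDegree.nonempty_iso_top {d : ℕ} (hreg : G.IsRegularOfDegree d) {u : V}
    (hu : insert u (G.neighborFinset u) = Finset.univ) :
    Nonempty (G ≃g (⊤ : SimpleGraph (Fin (d + 1)))) := by
  have hcard : Fintype.card V = d + 1 := by
    rw [← Finset.card_univ, ← hu, Finset.card_insert_of_notMem (by simp),
      card_neighborFinset_eq_degree, hreg u]
  have hG : G = ⊤ := by
    ext a b
    simp only [top_adj]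
    refine ⟨fun h ↦ h.ne, fun hab ↦ ?_⟩
    have : insert a (G.neighborFinset a) = Finset.univ := by
      rw [← Finset.card_eq_iff_eq_univ, Finset.card_insert_of_notMem (by simp),
        card_neighborFinset_eq_degree, hreg a, hcard]
    have hb : b ∈ insert a (G.neighborFinset a) := by simp [this]
    simpa [hab.symm] using hb
  subst hG
  exact ⟨Iso.completeGraph (Fintype.equivFinOfCardEq hcard)⟩

/-- If no closed neighborhood is all of `V`, then `G` has no triangle. -/
lemma IsRegularOfDegree.disjoint_neighborFinset_of_forall_isForcedWithin (hG : G.Connected) {k : ℕ}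
    (hk : 0 < k) (hreg : G.IsRegularOfDegree (k + 2))
    (H : ∀ a C, G.IsForcedWithin k a C → 2 ≤ a)
    (hu : ∀ u, insert u (G.neighborFinset u) ≠ Finset.univ) {u v : V} (huv : G.Adj u v) :
    Disjoint (G.neighborFinset u) (G.neighborFinset v) := by
  have hdeg : ∀ v, G.degree v ≤ k + 2 := fun v ↦ (hreg v).le
  have ht := fun u ↦ hreg.isForcedWithin_insert_neighborFinset hk H u
  rw [Finset.disjoint_left]
  intro w huw hvw
  simp only [mem_neighborFinset] at huw hvw
  have hsub : G.neighborFinset v ⊆ insert u (G.neighborFinset u) :=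
    (ht u).neighborFinset_subset hk hdeg H (x := u) (y := w) (by simp [huv]) (by simp)
      (by simp [huw]) huw.ne huv.symm hvw
  have heq : insert v (G.neighborFinset v) = insert u (G.neighborFinset u) := by
    refine Finset.eq_of_subset_of_card_le (Finset.insert_subset (by simp [huv]) hsub) ?_
    rw [Finset.card_insert_of_notMem (by simp), Finset.card_insert_of_notMem (by simp),
      card_neighborFinset_eq_degree, card_neighborFinset_eq_degree, hreg u, hreg v]
  obtain ⟨x, hx, y, hy, hxy⟩ := hG.exists_adj_notMem (by simp) (hu u)
  have hxu : x ≠ u := by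
    rintro rfl
    simp [hxy] at hy
  have hxv : x ≠ v := by
    rintro rfl
    rw [← heq] at hy
    simp [hxy] at hy
  have hux : G.Adj u x := by simpa [hxu] using hx
  have hvx : G.Adj v x := by
    rw [← heq] at hx
    simpa [hxv] using hx
  exact hy ((ht u).neighborFinset_subset hk hdeg H hx (x := u) (y := v) (by simp) (by simp [huv])
    huv.ne hux.symm hvx.symm (by simpa using hxy))

lemma IsRegularOfDegree.nonempty_iso_of_forall_isForcedWithin (hG : G.Connected) {k : ℕ}
    (hk : 0 < k) (hreg : G.IsRegularOfDegree (k + 2))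
    (H : ∀ a C, G.IsForcedWithin k a C → 2 ≤ a) :
    Nonempty (G ≃g (⊤ : SimpleGraph (Fin (k + 2 + 1)))) ∨
      Nonempty (G ≃g completeBipartiteGraph (Fin (k + 2)) (Fin (k + 2))) := by
  classical
  by_cases! hu : ∃ u, insert u (G.neighborFinset u) = Finset.univ
  · exact .inl (hreg.nonempty_iso_top hu.choose_spec)
  right
  have hdeg : ∀ v, G.degree v ≤ k + 2 := fun v ↦ (hreg v).le
  have htri {u v : V} (huv : G.Adj u v) :
      Disjoint (G.neighborFinset u) (G.neighborFinset v) :=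
    hreg.disjoint_neighborFinset_of_forall_isForcedWithin hG hk H hu huv
  have ht := fun u ↦ hreg.isForcedWithin_insert_neighborFinset hk H u
  have hN (u : V) : (G.neighborFinset u).card = k + 2 := by
    rw [card_neighborFinset_eq_degree, hreg u]
  -- a 4-cycle, from the last step of a minimal-deficit forcing process
  obtain ⟨b, b', y, y', hbb, hyy, h1, h2, h3, h4⟩ : ∃ b b' y y' : V, b ≠ b' ∧ y ≠ y' ∧
      G.Adj b y ∧ G.Adj b y' ∧ G.Adj b' y ∧ G.Adj b' y' := by
    obtain ⟨u₀⟩ := hG.nonempty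
    obtain ⟨C, hC, hmax⟩ := Finset.exists_max_image
      (Finset.univ.filter fun C : Finset V ↦ G.IsForcedWithin k 2 C ∧ C ≠ Finset.univ)
      Finset.card ⟨_, by simpa using ⟨ht u₀, hu u₀⟩⟩
    simp only [Finset.mem_filter, Finset.mem_univ, true_and] at hC hmax
    have hlast : ∀ v ∈ C, ∀ w ∉ C, G.Adj v w → ∀ z ∉ C, G.Adj v z := by
      intro v hv w hw hvw z hz
      have h' := (hC.1.eq_of_forall_two_le hk hdeg H hv hw hvw).2
      have hlt : C.card < (C ∪ G.neighborFinset v).card := Finset.card_lt_card <|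
        (Finset.ssubset_iff_of_subset Finset.subset_union_left).2 ⟨w, by simp [hvw], hw⟩
      by_contra hvz
      refine hlt.not_ge (hmax _ ⟨h', fun he ↦ ?_⟩)
      have : z ∈ C ∪ G.neighborFinset v := by simp [he]
      simp [hz, hvz] at this
    obtain ⟨b, hb, y, hy, hby⟩ := hG.exists_adj_notMem hC.1.1 hC.2
    have hcard := (hC.1.eq_of_forall_two_le hk hdeg H hb hy hby).1
    have hO : G.neighborFinset b \ C = Cᶜ := by
      ext z
      simp only [Finset.mem_sdiff, mem_neighborFinset, Finset.mem_compl]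
      exact ⟨fun h ↦ h.2, fun h ↦ ⟨hlast b hb y hy hby z h, h⟩⟩
    rw [hO] at hcard
    obtain ⟨y', hy', hne⟩ := Finset.exists_mem_ne (s := Cᶜ) (by lia) y
    have hin : 1 < (G.neighborFinset y ∩ C).card := by
      have e1 := Finset.card_sdiff_add_card_inter (G.neighborFinset y) C
      have e2 : G.neighborFinset y \ C ⊆ Cᶜ.erase y := by
        intro z
        simp only [Finset.mem_sdiff, mem_neighborFinset, Finset.mem_erase, Finset.mem_compl]
        exact fun h ↦ ⟨h.1.ne', h.2⟩
      have e3 := Finset.card_le_card e2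
      have e4 := Finset.card_erase_add_one (s := Cᶜ) (a := y) (by simpa using hy)
      have := hN y
      lia
    obtain ⟨b', hb', hbb⟩ := Finset.exists_mem_ne hin b
    simp only [Finset.mem_inter, mem_neighborFinset, Finset.mem_compl] at hb' hy'
    exact ⟨b, b', y, y', hbb.symm, hne.symm, hby, hlast b hb y hy hby y' hy', hb'.1.symm,
      hlast b' hb'.2 y hy hb'.1.symm y' hy'⟩
  -- the neighborhoods of the ends of an edge of the 4-cycle cover the graph
  have hdis := htri h1
  have htC : G.IsForcedWithin k 2 (G.neighborFinset b ∪ G.neighborFinset y) := by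
    have hb'N : b' ∉ insert b (G.neighborFinset b) := by
      have : b' ∉ G.neighborFinset b := Finset.disjoint_right.1 hdis (by simpa using h3.symm)
      simpa [hbb.symm] using this
    have := ((ht b).eq_of_forall_two_le hk hdeg H (v := y) (by simp [h1]) hb'N h3.symm).2
    rwa [Finset.insert_union, Finset.insert_eq_of_mem (by simp [h1.symm])] at this
  set C := G.neighborFinset b ∪ G.neighborFinset y with hCdef
  have hmem (x : V) : x ∈ C ↔ G.Adj b x ∨ G.Adj y x := by simp [hCdef]
  have hb' : G.neighborFinset b' = G.neighborFinset b := by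
    refine Finset.eq_of_subset_of_card_le ?_ (by rw [hN, hN])
    have hs := htC.neighborFinset_subset hk hdeg H (v := b') (x := y) (y := y')
      (by simp [hmem, h3.symm]) (by simp [hmem, h1]) (by simp [hmem, h2]) hyy h3 h4
    exact (htri h3).left_le_of_le_sup_right hs
  have hx : ∀ x ∈ G.neighborFinset b, G.neighborFinset x = G.neighborFinset y := by
    intro x hx
    have hb'x : x ∈ G.neighborFinset b' := hb' ▸ hx
    rw [mem_neighborFinset] at hx hb'x
    refine Finset.eq_of_subset_of_card_le ?_ (by rw [hN, hN])
    have hs := htC.neighborFinset_subset hk hdeg H (v := x) (x := b) (y := b') (by simp [hmem, hx])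
      (by simp [hmem, h1.symm]) (by simp [hmem, h3.symm]) hbb hx.symm hb'x.symm
    exact (htri hx).symm.left_le_of_le_sup_left hs
  have hz : ∀ z ∈ G.neighborFinset y, G.neighborFinset z = G.neighborFinset b := by
    intro z hz
    refine (Finset.eq_of_subset_of_card_le (fun x hxb ↦ ?_) (by rw [hN, hN])).symm
    rw [← hx x hxb] at hz
    simpa [G.adj_comm] using hz
  refine hreg.nonempty_iso_completeBipartiteGraph hdis ?_ hx hz
  by_contra hne
  obtain ⟨p, hp, q, hq, hpq⟩ := hG.exists_adj_notMem htC.1 hne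
  refine hq ?_
  have hq' : q ∈ G.neighborFinset p := by simpa using hpq
  rcases Finset.mem_union.1 hp with hp | hp
  · rw [hx p hp] at hq'
    exact Finset.mem_union_right _ hq'
  · rw [hz p hp] at hq'
    exact Finset.mem_union_left _ hq'

end SimpleGraph

/-- For a connected graph `G` of order `n` with maximum degree `Δ ≥ 2`,
if `(Δ−1)·Z(G) = (Δ−2)·n + 2` then `G ≅ C_n`, `G ≅ K_{Δ+1}` or `G ≅ K_{Δ,Δ}`. -/
theorem stmt1 {V : Type*} [Fintype V] (G : SimpleGraph V) [DecidableRel G.Adj]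
    (n Δ : ℕ) (hn : Fintype.card V = n) (hΔ : G.maxDegree = Δ) (hΔ2 : 2 ≤ Δ)
    (hconn : G.Connected)
    (hZ : (Δ - 1) * G.zeroForcingNumber = (Δ - 2) * n + 2) :
    Nonempty (G ≃g SimpleGraph.cycleGraph n) ∨
      Nonempty (G ≃g (⊤ : SimpleGraph (Fin (Δ + 1)))) ∨
      Nonempty (G ≃g completeBipartiteGraph (Fin Δ) (Fin Δ)) := by
  classical
  obtain ⟨k, rfl⟩ : ∃ k, Δ = k + 2 := ⟨Δ - 2, by lia⟩
  have hdeg : ∀ v, G.degree v ≤ k + 2 := fun v ↦ hΔ ▸ G.degree_le_maxDegree v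
  have H : ∀ a C, G.IsForcedWithin k a C → 2 ≤ a := by
    intro a C h
    obtain ⟨T, hT, hcard⟩ := h.exists_isZeroForcingSet hconn hdeg
    have hle : (k + 1) * G.zeroForcingNumber ≤ (k + 1) * T.card :=
      Nat.mul_le_mul_left _ hT.zeroForcingNumber_le
    rw [show (k + 2 - 1) = k + 1 by lia, show k + 2 - 2 = k by lia] at hZ
    rw [hZ] at hle
    zify at hle
    rw [hn] at hcard
    linarith
  have : Nontrivial V := by
    by_contra h
    rw [not_nontrivial_iff_subsingleton] at h
    rw [G.maxDegree_of_subsingleton] at hΔ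
    lia
  have hreg := SimpleGraph.isRegularOfDegree_of_forall_isForcedWithin hconn hdeg H
  rcases Nat.eq_zero_or_pos k with rfl | hk
  · exact .inl (hn ▸ hreg.nonempty_iso_cycleGraph hconn)
  · exact .inr (hreg.nonempty_iso_of_forall_isForcedWithin hconn hk H)
end

section
/- Let G be a connected Δ-regular finite simple graph of order n with Δ ≥ 3 satisfying (Δ−1)·Z(G) = (Δ−2)·n + 2. Let S be a zero forcing set of G of minimum cardinality among all zero forcing sets whose complement induces a connected subgraph, and let S̄ = V(G)∖S. Then (Δ−1)·|S| = (Δ−2)·n + 2, every vertex of S has exactly one neighbor in S̄, and the induced subgraph G[S̄] is a tree. -/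
namespace SimpleGraph

variable {V : Type*} {G : SimpleGraph V} {S T : Set V}

theorem ZeroForces.trans {v : V} (h : G.ZeroForces S v) (hST : ∀ u ∈ S, G.ZeroForces T u) :
    G.ZeroForces T v := by
  induction h with
  | init hv => exact hST _ hv
  | force _ hadj _ ihu ihall => exact .force ihu hadj ihall

/-- Deleting from a zero forcing set `S` a neighbor of a vertex whose closed neighborhood lies in
`S` leaves a zero forcing set. -/
theorem IsZeroForcingSet.diff_singleton {v w : V} (hS : G.IsZeroForcingSet S) (hv : v ∈ S)
    (hvw : G.Adj v w) (hnbr : ∀ u, G.Adj v u → u ∈ S) : G.IsZeroForcingSet (S \ {w}) := by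
  refine fun x => (hS x).trans fun u hu => ?_
  by_cases huw : u = w
  · subst huw
    exact .force (.init ⟨hv, hvw.ne⟩) hvw fun y hy hyu => .init ⟨hnbr y hy, hyu⟩
  · exact .init ⟨hu, huw⟩

theorem zeroForcingNumber_le_ncard (hS : G.IsZeroForcingSet S) : G.zeroForcingNumber ≤ S.ncard :=
  Nat.sInf_le ⟨S, hS, rfl⟩

/-- Adding to a connected induced subgraph a vertex adjacent to it keeps it connected. -/
theorem Connected.induce_compl_diff_singleton {w x : V} (hS : (G.induce Sᶜ).Connected)
    (hx : x ∈ Sᶜ) (hwx : G.Adj w x) : (G.induce (S \ {w})ᶜ).Connected := by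
  have heq : (S \ {w})ᶜ = Sᶜ ∪ {w} := by
    ext y
    simp only [Set.mem_compl_iff, Set.mem_sdiff, Set.mem_singleton_iff, Set.mem_union]
    tauto
  rw [heq]
  exact connected_induce_union hS.preconnected Preconnected.of_subsingleton hx rfl hwx.symm

/-- In a connected graph, in a zero forcing set of minimum cardinality among those with connected
complement, every vertex has a neighbor in the complement. -/
theorem exists_adj_mem_compl_of_minimal [Finite V] (hconn : G.Connected)
    (hzf : G.IsZeroForcingSet S) (hSc : (G.induce Sᶜ).Connected)
    (hmin : ∀ T : Set V, G.IsZeroForcingSet T → (G.induce Tᶜ).Connected → S.ncard ≤ T.ncard)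
    {v : V} (hv : v ∈ S) : ∃ w ∈ Sᶜ, G.Adj v w := by
  by_contra! hcon
  obtain ⟨⟨z, hz⟩⟩ := hSc.nonempty
  obtain ⟨p⟩ := hconn.preconnected v z
  obtain ⟨d, -, ⟨hd, hdn⟩, hd'⟩ := p.exists_boundary_dart {a | a ∈ S ∧ ∀ w ∈ Sᶜ, ¬ G.Adj a w}
    ⟨hv, hcon⟩ (fun h => hz h.1)
  have hnbr : ∀ u, G.Adj d.fst u → u ∈ S := fun u hu => by_contra fun h => hdn u h hu
  have hsnd := hnbr _ d.adj
  have hex : ∃ x ∈ Sᶜ, G.Adj d.snd x := by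
    by_contra! h
    exact hd' ⟨hsnd, h⟩
  obtain ⟨x, hx, hadj⟩ := hex
  have hle := hmin _ (hzf.diff_singleton hd d.adj hnbr) (hSc.induce_compl_diff_singleton hx hadj)
  exact absurd hle (Set.ncard_sdiff_singleton_lt_of_mem hsnd).not_ge

/-- The degrees over `Sᶜ` in a regular graph count the edges inside `Sᶜ` twice and the edges
between `S` and `Sᶜ` once. -/
theorem IsRegularOfDegree.mul_ncard_compl_eq [Fintype V] [DecidableRel G.Adj] {d : ℕ}
    (hreg : G.IsRegularOfDegree d) (S : Finset V) :
    d * (S : Set V)ᶜ.ncard = 2 * Nat.card (G.induce (S : Set V)ᶜ).edgeSet +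
      ∑ v ∈ S, {w : V | w ∈ (S : Set V)ᶜ ∧ G.Adj v w}.ncard := by
  classical
  have hcross : ∑ v ∈ S, {w : V | w ∈ (S : Set V)ᶜ ∧ G.Adj v w}.ncard
      = ∑ w ∈ Sᶜ, (S.filter fun v => G.Adj v w).card := by
    refine Eq.trans ?_ (Finset.sum_card_bipartiteAbove_eq_sum_card_bipartiteBelow G.Adj)
    refine Finset.sum_congr rfl fun v _ => ?_
    rw [← Set.ncard_coe_finset]
    congr 1
    ext w
    simp [Finset.bipartiteAbove]
  have hinner : 2 * Nat.card (G.induce (S : Set V)ᶜ).edgeSet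
      = ∑ w ∈ Sᶜ, (Sᶜ.filter fun v => G.Adj v w).card := by
    rw [Nat.card_eq_fintype_card, ← edgeFinset_card, ← sum_degrees_eq_twice_card_edges,
      Finset.sum_subtype (p := fun x => x ∈ (S : Set V)ᶜ) Sᶜ (by simp)]
    refine Finset.sum_congr rfl fun w _ => ?_
    rw [← card_neighborFinset_eq_degree, ← Finset.card_map (Function.Embedding.subtype _)]
    congr 1
    ext v
    simp [G.adj_comm, and_comm]
  have hcard : (S : Set V)ᶜ.ncard = Sᶜ.card := by
    rw [← Finset.coe_compl, Set.ncard_coe_finset]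
  rw [hcross, hinner, ← Finset.sum_add_distrib, hcard, mul_comm, ← smul_eq_mul, ← Finset.sum_const]
  refine Finset.sum_congr rfl fun w _ => ?_
  rw [← hreg.degree_eq w, ← card_neighborFinset_eq_degree,
    ← Finset.card_filter_add_card_filter_not (fun v => v ∈ Sᶜ)]
  congr 2 <;> ext v <;> simp [G.adj_comm, and_comm]

end SimpleGraph

/-- Under the equality hypothesis, a minimum zero forcing set `S` with
connected complement satisfies `(Δ−1)·|S| = (Δ−2)·n + 2`, every vertex of `S` has
exactly one neighbor in `S̄ = Sᶜ`, and `G[S̄]` is a tree. -/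
theorem stmt7 {V : Type*} [Fintype V] (G : SimpleGraph V) [DecidableRel G.Adj]
    (n Δ : ℕ) (hn : Fintype.card V = n) (hΔ3 : 3 ≤ Δ)
    (hreg : G.IsRegularOfDegree Δ) (hconn : G.Connected)
    (hZ : (Δ - 1) * G.zeroForcingNumber = (Δ - 2) * n + 2)
    (S : Set V) (hzf : G.IsZeroForcingSet S)
    (hSc : (G.induce Sᶜ).Connected)
    (hmin : ∀ T : Set V, G.IsZeroForcingSet T → (G.induce Tᶜ).Connected →
      S.ncard ≤ T.ncard) :
    (Δ - 1) * S.ncard = (Δ - 2) * n + 2 ∧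
      (∀ v ∈ S, {w : V | w ∈ Sᶜ ∧ G.Adj v w}.ncard = 1) ∧
      (G.induce Sᶜ).IsTree := by
  classical
  obtain ⟨F, rfl⟩ : ∃ F : Finset V, (F : Set V) = S := ⟨S.toFinset, by simp⟩
  have hpos : ∀ v ∈ F, 1 ≤ {w : V | w ∈ (F : Set V)ᶜ ∧ G.Adj v w}.ncard := fun v hv =>
    (Set.ncard_pos (Set.toFinite _)).2
      (SimpleGraph.exists_adj_mem_compl_of_minimal hconn hzf hSc hmin hv)
  have hcount := hreg.mul_ncard_compl_eq F
  have hcross : (F : Set V).ncard ≤ ∑ v ∈ F, {w : V | w ∈ (F : Set V)ᶜ ∧ G.Adj v w}.ncard := by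
    rw [Set.ncard_coe_finset, Finset.card_eq_sum_ones]
    exact Finset.sum_le_sum hpos
  have hedge := hSc.card_vert_le_card_edgeSet_add_one
  rw [Nat.card_coe_set_eq] at hedge
  have hle := SimpleGraph.zeroForcingNumber_le_ncard hzf
  have hcompl := Set.ncard_add_ncard_compl (F : Set V)
  rw [Nat.card_eq_fintype_card, hn] at hcompl
  obtain ⟨k, rfl⟩ : ∃ k, Δ = k + 2 := ⟨Δ - 2, by omega⟩
  rw [show k + 2 - 1 = k + 1 by omega, show k + 2 - 2 = k by omega, ← hcompl] at hZ ⊢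
  have hmul := Nat.mul_le_mul_left (k + 1) hle
  have heq : (F : Set V).ncard = ∑ v ∈ F, {w : V | w ∈ (F : Set V)ᶜ ∧ G.Adj v w}.ncard := by
    linarith
  refine ⟨by linarith, ?_, ?_⟩
  · rw [Set.ncard_coe_finset, Finset.card_eq_sum_ones] at heq
    exact fun v hv => ((Finset.sum_eq_sum_iff_of_le hpos).1 heq v hv).symm
  · rw [SimpleGraph.isTree_iff_connected_and_card, Nat.card_coe_set_eq (F : Set V)ᶜ]
    exact ⟨hSc, by linarith⟩
end
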